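/- arXiv:2511.12505 — 2 statements merged into one kernel-verified Lean document; each statement's English description precedes it below -/
import Mathlib

section
/- Let n ≥ 3 be an integer and let G be a star-colouring of K_n. If every vertex of K_n is a centre of at least two colour classes (stars), then G contains a rainbow Hamilton cycle C_n. -/
open SimpleGraph

/-- An edge-colouring of the complete graph on `α` (only values on
non-diagonal pairs are relevant). -/
abbrev EdgeColouring (α : Type*) := Sym2 α → ℕ

/-- A star-colouring: every colour class is a star, i.e. any two edges of the
same colour share a vertex, and no colour class contains a triangle. -/
def IsStarColouring {α : Type*} (c : EdgeColouring α) : Prop :=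
  (∀ a b x y : α, a ≠ b → x ≠ y → c s(a, b) = c s(x, y) →
      a = x ∨ a = y ∨ b = x ∨ b = y) ∧
  ∀ a b d : α, a ≠ b → b ≠ d → a ≠ d →
      ¬(c s(a, b) = c s(b, d) ∧ c s(b, d) = c s(a, d))

/-- The number of colours used on the edges of the complete graph on `α`. -/
noncomputable def colourCount {α : Type*} (c : EdgeColouring α) : ℕ :=
  (c '' {e : Sym2 α | ¬ e.IsDiag}).ncard

/-- The colouring `c` of the complete graph on `α` contains a rainbow copy of
the graph `H`: there is an injection of `V(H)` such that distinct edges of `H`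
receive distinct colours. -/
def HasRainbowCopy {α β : Type*} (c : EdgeColouring α) (H : SimpleGraph β) : Prop :=
  ∃ f : β ↪ α, ∀ u v x y : β, H.Adj u v → H.Adj x y → s(u, v) ≠ s(x, y) →
    c s(f u, f v) ≠ c s(f x, f y)

/-- The star-anti-Ramsey number `ar*(n, H)`: the maximum number of colours in a
star-colouring of `K_n` with no rainbow copy of `H`. -/
noncomputable def starAntiRamsey (n : ℕ) {β : Type*} (H : SimpleGraph β) : ℕ :=
  sSup {s | ∃ c : EdgeColouring (Fin n), IsStarColouring c ∧ colourCount c = s ∧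
    ¬ HasRainbowCopy c H}

/-- The lexical colouring of `K_n`: the edge `{i, j}` with `i < j` gets colour `i`. -/
def lexColouring (n : ℕ) : EdgeColouring (Fin n) :=
  Sym2.lift ⟨fun i j => min i.1 j.1, fun i j => by simp [min_comm]⟩

/-- `c` is a lexical colouring with respect to some ordering of the vertices. -/
def IsLexical {n : ℕ} (c : EdgeColouring (Fin n)) : Prop :=
  ∃ v : Fin n ≃ Fin n, ∀ i j i' j' : Fin n, i < j → i' < j' →
    (c s(v i, v j) = c s(v i', v j') ↔ i = i')

/-- `v` is a centre of the colour class of colour `m`: the class is nonempty and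
every edge of colour `m` is incident to `v` (for star-colourings this is exactly
a vertex of maximum degree in the class). -/
def IsCentre {α : Type*} (c : EdgeColouring α) (v : α) (m : ℕ) : Prop :=
  (∃ e : Sym2 α, ¬ e.IsDiag ∧ c e = m ∧ v ∈ e) ∧
  ∀ e : Sym2 α, ¬ e.IsDiag → c e = m → v ∈ e

/-- `G` contains a copy of `F` as a subgraph. -/
def ContainsCopy {α β : Type*} (F : SimpleGraph α) (G : SimpleGraph β) : Prop :=
  ∃ f : α ↪ β, ∀ u v, F.Adj u v → G.Adj (f u) (f v)

/-- The extremal (Turán) number `ex(n, F)`. -/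
noncomputable def extremalNumber (n : ℕ) {α : Type*} (F : SimpleGraph α) : ℕ :=
  sSup {m | ∃ G : SimpleGraph (Fin n), ¬ ContainsCopy F G ∧ G.edgeSet.ncard = m}

/-- The join of two graphs: vertex-disjoint copies of `G` and `H` together with
all edges between them. -/
def graphJoin {α β : Type*} (G : SimpleGraph α) (H : SimpleGraph β) :
    SimpleGraph (α ⊕ β) :=
  SimpleGraph.fromRel (fun x y => match x, y with
    | Sum.inl a, Sum.inl b => G.Adj a b
    | Sum.inr a, Sum.inr b => H.Adj a b
    | Sum.inl _, Sum.inr _ => True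
    | Sum.inr _, Sum.inl _ => False)

/-- The complete bipartite graph `K_{s,t}` minus one edge. -/
def Kstminus (s t : ℕ) (hs : 0 < s) (ht : 0 < t) : SimpleGraph (Fin s ⊕ Fin t) :=
  (completeBipartiteGraph (Fin s) (Fin t)).deleteEdges
    {s(Sum.inl ⟨0, hs⟩, Sum.inr ⟨0, ht⟩)}

namespace StarColouring

section Digraph

variable {α : Type*} {E : α → α → Prop}

/-- Every vertex of `U` can be reached from `w` inside `U`, in terms of cuts. -/
def IsRoot (E : α → α → Prop) (U : Finset α) (w : α) : Prop :=
  ∀ X ⊆ U, w ∈ X → X ≠ U → ∃ x ∈ X, ∃ y ∈ U, y ∉ X ∧ E x y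

lemma exists_insert_path (hE : ∀ x y, E x y ∨ E y x) (u : α) (t : List α) :
    ∀ x, (x :: t).IsChain E → (∃ z ∈ x :: t, E z u) →
      ∃ t', t'.Perm (u :: t) ∧ (x :: t').IsChain E := by
  induction t with
  | nil =>
    rintro x - ⟨z, hz, hzu⟩
    obtain rfl : z = x := by simpa using hz
    exact ⟨[u], List.Perm.refl _, by simpa using hzu⟩
  | cons y s ih =>
    rintro x hc ⟨z, hz, hzu⟩
    rw [List.isChain_cons_cons] at hc
    by_cases h : E x u ∧ E u y
    · exact ⟨u :: y :: s, List.Perm.refl _, by simp [h.1, h.2, hc.2]⟩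
    · have : ∃ z ∈ y :: s, E z u := by
        rcases List.mem_cons.1 hz with rfl | hz
        · exact ⟨y, by simp, (hE u y).resolve_left fun h' => h ⟨hzu, h'⟩⟩
        · exact ⟨z, hz, hzu⟩
      obtain ⟨s', hs, hs'⟩ := ih y hc.2 this
      exact ⟨y :: s', (hs.cons y).trans (.swap _ _ _), by simp [hc.1, hs']⟩

lemma exists_insert_of_head (hE : ∀ x y, E x y ∨ E y x) (u e : α) (t : List α) :
    ∀ x, (x :: (t ++ [e])).IsChain E → E x u → (∃ z ∈ t ++ [e], E u z) →
      ∃ t', t'.Perm (u :: t) ∧ (x :: (t' ++ [e])).IsChain E := by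
  induction t with
  | nil =>
    rintro x - hx ⟨z, hz, hzu⟩
    obtain rfl : z = e := by simpa using hz
    exact ⟨[u], List.Perm.refl _, by simp [hx, hzu]⟩
  | cons y s ih =>
    rintro x hc hx ⟨z, hz, hzu⟩
    rw [List.cons_append, List.isChain_cons_cons] at hc
    by_cases h : E u y
    · exact ⟨u :: y :: s, List.Perm.refl _, by simp [h, hx, hc.2]⟩
    · have hz' : z ∈ s ++ [e] := by
        rcases List.mem_cons.1 hz with rfl | hz
        · exact absurd hzu h
        · exact hz
      obtain ⟨s', hs, hs'⟩ := ih y hc.2 ((hE u y).resolve_left h) ⟨z, hz', hzu⟩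
      exact ⟨y :: s', (hs.cons y).trans (.swap _ _ _), by simp [hc.1, hs']⟩

lemma exists_insert_of_last (hE : ∀ x y, E x y ∨ E y x) (u e : α) (he : E u e) (t : List α) :
    ∀ x, (x :: (t ++ [e])).IsChain E → (∃ z ∈ x :: t, E z u) →
      ∃ t', t'.Perm (u :: t) ∧ (x :: (t' ++ [e])).IsChain E := by
  induction t with
  | nil =>
    rintro x - ⟨z, hz, hzu⟩
    obtain rfl : z = x := by simpa using hz
    exact ⟨[u], List.Perm.refl _, by simp [he, hzu]⟩
  | cons y s ih =>
    rintro x hc ⟨z, hz, hzu⟩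
    rw [List.cons_append, List.isChain_cons_cons] at hc
    by_cases h : E x u
    · exact exists_insert_of_head hE u e (y :: s) x (by simpa using hc) h ⟨e, by simp, he⟩
    · have hz' : z ∈ y :: s := by
        rcases List.mem_cons.1 hz with rfl | hz
        · exact absurd hzu h
        · exact hz
      obtain ⟨s', hs, hs'⟩ := ih y hc.2 ⟨z, hz', hzu⟩
      exact ⟨y :: s', (hs.cons y).trans (.swap _ _ _), by simp [hc.1, hs']⟩

variable [DecidableEq α]

/-- A list property of bounded length that can always be extended until the list exhausts `U`
holds for an enumeration of `U`. -/
lemma exists_exhausting {U : Finset α} {P : List α → Prop} (l₀ : List α) (h₀ : P l₀)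
    (hP : ∀ l, P l → l.Nodup ∧ l.toFinset ⊆ U)
    (hext : ∀ l, P l → l.toFinset ≠ U → ∃ l', P l' ∧ l.length < l'.length) :
    ∃ l, P l ∧ l.toFinset = U := by
  by_contra! hne
  have : ∀ k, ∃ l, P l ∧ k ≤ l.length := by
    intro k
    induction k with
    | zero => exact ⟨l₀, h₀, Nat.zero_le _⟩
    | succ k ih =>
      obtain ⟨l, hl, hk⟩ := ih
      obtain ⟨l', hl', hlt⟩ := hext l hl (hne l hl)
      exact ⟨l', hl', by omega⟩
  obtain ⟨l, hl, hk⟩ := this (U.card + 1)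
  have h1 := Finset.card_le_card (hP l hl).2
  rw [List.toFinset_card_of_nodup (hP l hl).1] at h1
  omega

/-- A root of a semicomplete digraph is the first vertex of a Hamilton path. -/
lemma IsRoot.exists_path (hE : ∀ x y, E x y ∨ E y x) {U : Finset α} {w : α} (hw : w ∈ U)
    (hr : IsRoot E U w) :
    ∃ t : List α, (w :: t).Nodup ∧ (w :: t).toFinset = U ∧ (w :: t).IsChain E := by
  obtain ⟨l, ⟨⟨hn, -⟩, t, rfl, hc⟩, hU⟩ := exists_exhausting (U := U)
    (P := fun l => (l.Nodup ∧ l.toFinset ⊆ U) ∧ ∃ t, l = w :: t ∧ l.IsChain E)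
    [w] (by simp [hw]) (fun l h => h.1) (by
      rintro l ⟨⟨hn, hs⟩, t, rfl, hc⟩ hne
      obtain ⟨x, hx, y, hyU, hy, hxy⟩ := hr _ hs (by simp) hne
      obtain ⟨t', hp, hc'⟩ := exists_insert_path hE y t w hc ⟨x, List.mem_toFinset.1 hx, hxy⟩
      have hp' : (w :: t').Perm (y :: w :: t) := (hp.cons w).trans (.swap _ _ _)
      refine ⟨w :: t', ⟨⟨hp'.nodup_iff.2 (List.nodup_cons.2 ⟨by simpa using hy, hn⟩), ?_⟩,
        t', rfl, hc'⟩, by simp [hp'.length_eq]⟩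
      rw [List.toFinset_eq_of_perm _ _ hp', List.toFinset_cons]
      exact Finset.insert_subset hyU hs)
  exact ⟨t, hn, hU, hc⟩

/-- Camion's theorem: a strong semicomplete digraph has a directed Hamilton cycle. -/
lemma exists_directed_cycle (hE : ∀ x y, E x y ∨ E y x) {U : Finset α} (hne : U.Nonempty)
    (hU : ∀ w ∈ U, IsRoot E U w) :
    ∃ x t, (x :: t).Nodup ∧ (x :: t).toFinset = U ∧ (x :: (t ++ [x])).IsChain E := by
  obtain ⟨x₀, hx₀⟩ := hne
  have hrefl : ∀ x, E x x := fun x => (hE x x).elim id id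
  obtain ⟨l, ⟨⟨hn, -⟩, x, t, rfl, hc⟩, hU⟩ := exists_exhausting (U := U)
    (P := fun l => (l.Nodup ∧ l.toFinset ⊆ U) ∧ ∃ x t, l = x :: t ∧ (x :: (t ++ [x])).IsChain E)
    [x₀] ⟨by simp [hx₀], x₀, [], rfl, by simp [hrefl]⟩ (fun l h => h.1) (by
      rintro l ⟨⟨hn, hs⟩, x, t, rfl, hc⟩ hne
      have insert_one : ∀ u ∈ U, u ∉ x :: t →
          (∃ t', t'.Perm (u :: t) ∧ (x :: (t' ++ [x])).IsChain E) →
          ∃ l', ((l'.Nodup ∧ l'.toFinset ⊆ U) ∧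
            ∃ x t, l' = x :: t ∧ (x :: (t ++ [x])).IsChain E) ∧
            (x :: t).length < l'.length := by
        rintro u huU hu ⟨t', hp, hc'⟩
        have hp' : (x :: t').Perm (u :: x :: t) := (hp.cons x).trans (.swap _ _ _)
        refine ⟨x :: t', ⟨⟨hp'.nodup_iff.2 (List.nodup_cons.2 ⟨hu, hn⟩), ?_⟩,
          x, t', rfl, hc'⟩, by simp [hp'.length_eq]⟩
        rw [List.toFinset_eq_of_perm _ _ hp', List.toFinset_cons]
        exact Finset.insert_subset huU hs
      by_cases hmix : ∃ u ∈ U, u ∉ x :: t ∧ (∃ y ∈ x :: t, E y u) ∧ ∃ z ∈ x :: t, E u z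
      · obtain ⟨u, huU, hu, hin, z, hz, huz⟩ := hmix
        refine insert_one u huU hu ?_
        by_cases hxu : E x u
        · exact exists_insert_of_head hE u x t x hc hxu
            ⟨z, by simpa [or_comm] using hz, huz⟩
        · exact exists_insert_of_last hE u x ((hE x u).resolve_left hxu) t x hc hin
      · push Not at hmix
        have hxU : x ∈ U := hs (by simp)
        by_cases hA : ∃ a ∈ U, a ∉ x :: t ∧ ∀ y ∈ x :: t, ¬ E y a
        · obtain ⟨a, haU, hat, ha⟩ := hA
          classical
          obtain ⟨b, hb, a', ha'U, ha', hba⟩ := hU x hxU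
            (U.filter fun b => b ∈ x :: t ∨ ∃ y ∈ x :: t, E y b) (Finset.filter_subset _ _)
            (by simp [hxU]) (fun h => by
              have := h ▸ haU
              simp only [Finset.mem_filter] at this
              rcases this.2 with h | ⟨y, hy, hya⟩
              · exact hat h
              · exact ha y hy hya)
          simp only [Finset.mem_filter, not_and, not_or, not_exists] at hb ha'
          obtain ⟨ha't, ha'⟩ := ha' ha'U
          have hbt : b ∉ x :: t := fun h => ha' b h hba
          have hbx : E x b := by
            obtain ⟨y, hy, hyb⟩ := hb.2.resolve_left hbt
            exact (hE x b).resolve_right (hmix b hb.1 hbt ⟨y, hy, hyb⟩ x (by simp))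
          have hab : a' ≠ b := by
            rintro rfl
            exact ha' x (by simp) hbx
          have hout : ∀ y ∈ x :: t, E a' y := fun y hy => (hE a' y).resolve_right (ha' y hy)
          refine ⟨x :: b :: a' :: t, ⟨⟨?_, ?_⟩, x, b :: a' :: t, rfl, ?_⟩, by simp⟩
          · simp only [List.nodup_cons, List.mem_cons, not_or] at hn hbt ha't ⊢
            tauto
          · intro z hz
            simp only [List.toFinset_cons, Finset.mem_insert] at hz hs
            rcases hz with rfl | rfl | rfl | hz
            exacts [hxU, hb.1, ha'U, hs (by simp [hz])]
          · rw [List.cons_append, List.cons_append, List.isChain_cons_cons,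
              List.isChain_cons_cons]
            refine ⟨hbx, hba, ?_⟩
            cases t with
            | nil => simpa using hout x (by simp)
            | cons y s =>
              simp only [List.cons_append, List.isChain_cons_cons] at hc ⊢
              exact ⟨hout y (by simp), hc.2⟩
        · exfalso
          push Not at hA
          obtain ⟨u, huU, hu⟩ : ∃ u ∈ U, u ∉ x :: t := by
            by_contra! h
            exact hne (hs.antisymm fun u hu => List.mem_toFinset.2 (h u hu))
          obtain ⟨b, hb, y, hyU, hy, hby⟩ := hU u huU (U \ (x :: t).toFinset)
            Finset.sdiff_subset (by simpa using ⟨huU, by simpa using hu⟩)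
            (fun h => by
              have := h ▸ hxU
              simp at this)
          rw [Finset.mem_sdiff, List.mem_toFinset] at hb hy
          obtain ⟨z, hz, hzb⟩ := hA b hb.1 hb.2
          exact hmix b hb.1 hb.2 ⟨z, hz, hzb⟩ y (by tauto) hby)
  exact ⟨x, t, hn, hU, hc⟩

/-- In a strong semicomplete digraph with a chosen out-neighbour for each vertex, some vertex `v`
can be deleted so that its chosen out-neighbour is a root of what is left. -/
lemma exists_isRoot_erase (hE : ∀ x y, E x y ∨ E y x) {S : Finset α} (hne : S.Nonempty)
    (hS : ∀ w ∈ S, IsRoot E S w) (f : α → α) (hfS : ∀ v ∈ S, f v ∈ S)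
    (hfE : ∀ v ∈ S, E v (f v)) :
    ∃ v ∈ S, IsRoot E (S.erase v) (f v) := by
  have key : ∀ k, ∀ v ∈ S, ∀ X ⊆ S.erase v, X.card = k → X.Nonempty → X ≠ S.erase v →
      (∀ x ∈ X, ∀ y ∈ S.erase v, y ∉ X → ¬ E x y) → ∃ v ∈ S, IsRoot E (S.erase v) (f v) := by
    intro k
    induction k using Nat.strong_induction_on with
    | _ k ih =>
      rintro v hv X hX rfl ⟨t, ht⟩ hXne hXcl
      have htS : t ∈ S := Finset.mem_of_mem_erase (hX ht)
      by_contra hcon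
      have htr : ¬ IsRoot E (S.erase t) (f t) := fun h => hcon ⟨t, htS, h⟩
      unfold IsRoot at htr
      push Not at htr
      obtain ⟨Y, hY, hfY, hYne, hYcl⟩ := htr
      have htY : t ∉ Y := fun h => by simpa using hY h
      obtain ⟨u, hu, huX⟩ : ∃ u ∈ S.erase v, u ∉ X := by
        by_contra! h
        exact hXne (hX.antisymm h)
      have hvX : v ∉ X := fun h => by simpa using hX h
      by_cases hvY : v ∈ Y
      · have hUY : ∀ u ∈ S.erase v, u ∉ X → u ∈ Y := by
          intro u hu huX
          by_contra huY
          obtain ⟨x, hx, y, hyS, hy, hxy⟩ := hS v hv (Y ∪ X)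
            (Finset.union_subset (hY.trans (Finset.erase_subset _ _))
              (hX.trans (Finset.erase_subset _ _))) (by simp [hvY])
            (fun h => by
              have := h ▸ Finset.mem_of_mem_erase hu
              simp [huX, huY] at this)
          rw [Finset.mem_union, not_or] at hy
          rcases Finset.mem_union.1 hx with hx | hx
          · exact hYcl x hx y (Finset.mem_erase.2 ⟨fun h => hy.2 (h ▸ ht), hyS⟩) hy.1 hxy
          · exact hXcl x hx y (Finset.mem_erase.2 ⟨fun h => hy.1 (h ▸ hvY), hyS⟩) hy.2 hxy
        refine hYne (hY.antisymm fun z hz => ?_)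
        by_contra hzY
        by_cases hzX : z ∈ X
        · exact (hE u z).elim (hYcl u (hUY u hu huX) z hz hzY) (hXcl z hzX u hu huX)
        · refine hzY (hUY z (Finset.mem_erase.2 ⟨?_, Finset.mem_of_mem_erase hz⟩) hzX)
          rintro rfl
          exact hzY hvY
      · have hfX : f t ∈ X := by
          by_contra h
          refine hXcl t ht (f t) (Finset.mem_erase.2 ⟨?_, hfS t htS⟩) h (hfE t htS)
          rintro h'
          exact hvY (h' ▸ hfY)
        refine hcon (ih (X ∩ Y).card (Finset.card_lt_card ?_) t htS (X ∩ Y)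
          (Finset.inter_subset_right.trans hY) rfl ⟨f t, by simp [hfX, hfY]⟩ ?_ ?_)
        · exact ⟨Finset.inter_subset_left, fun h => htY (Finset.mem_inter.1 (h ht)).2⟩
        · intro h
          have : u ∈ S.erase t := Finset.mem_erase.2
            ⟨fun h => huX (h ▸ ht), Finset.mem_of_mem_erase hu⟩
          rw [← h] at this
          exact huX (Finset.mem_inter.1 this).1
        · intro x hx y hy hyXY hxy
          rw [Finset.mem_inter] at hx hyXY
          by_cases hyY : y ∈ Y
          · refine hXcl x hx.1 y (Finset.mem_erase.2 ⟨?_, Finset.mem_of_mem_erase hy⟩)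
              (fun h => hyXY ⟨h, hyY⟩) hxy
            rintro rfl
            exact hvY hyY
          · exact hYcl x hx.2 y hy hyY hxy
  obtain ⟨v, hv⟩ := hne
  by_contra hcon
  have hvr : ¬ IsRoot E (S.erase v) (f v) := fun h => hcon ⟨v, hv, h⟩
  unfold IsRoot at hvr
  push Not at hvr
  obtain ⟨X, hX, hfX, hXne, hXcl⟩ := hvr
  exact hcon (key _ v hv X hX rfl ⟨_, hfX⟩ hXne hXcl)

end Digraph

section Colouring

variable {α : Type*} {c : EdgeColouring α}

/-- `x` is a centre of the colour class of the edge `xy` (or `x = y`). -/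
def Dominates (c : EdgeColouring α) (x y : α) : Prop :=
  x = y ∨ IsCentre c x (c s(x, y))

lemma dominates_total (hc : IsStarColouring c) (x y : α) :
    Dominates c x y ∨ Dominates c y x := by
  by_contra! h
  obtain ⟨h1, h2⟩ := h
  simp only [Dominates, not_or, IsCentre, not_and] at h1 h2
  obtain ⟨hxy, h1⟩ := h1
  have h1 := h1 ⟨s(x, y), by simpa using hxy, rfl, by simp⟩
  have h2 := h2.2 ⟨s(y, x), by simpa using Ne.symm hxy, rfl, by simp⟩
  push Not at h1 h2
  obtain ⟨e, he, hec, hex⟩ := h1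
  obtain ⟨e', he', hec', hey⟩ := h2
  induction e with | _ a b
  induction e' with | _ a' b'
  simp only [Sym2.mk_isDiag_iff, Sym2.mem_iff, not_or] at he he' hex hey
  rw [Sym2.eq_swap (a := y)] at hec'
  have k1 := hc.1 _ _ _ _ hxy he hec.symm
  have k2 := hc.1 _ _ _ _ hxy he' hec'.symm
  have k3 := hc.1 _ _ _ _ he he' (hec.trans hec'.symm)
  have tri : ∀ z, z ≠ x → z ≠ y → c s(y, z) = c s(x, y) → c s(x, z) = c s(x, y) → False :=
    fun z hzx hzy h h' => hc.2 x y z hxy hzy.symm hzx.symm ⟨h.symm, h.trans h'.symm⟩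
  rcases k1 with rfl | rfl | rfl | rfl
  · simp at hex
  · simp at hex
  · rcases k2 with rfl | rfl | rfl | rfl
    · exact tri b (by tauto) (by tauto) hec (by grind)
    · exact tri b (by tauto) (by tauto) hec (by grind [Sym2.eq_swap])
    · simp at hey
    · simp at hey
  · rw [Sym2.eq_swap] at hec
    rcases k2 with rfl | rfl | rfl | rfl
    · exact tri a (by tauto) (by tauto) hec (by grind)
    · exact tri a (by tauto) (by tauto) hec (by grind [Sym2.eq_swap])
    · simp at hey
    · simp at hey

lemma Dominates.colour_ne {x y z : α} (h : Dominates c x y) (hxy : x ≠ y) (hxz : x ≠ z)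
    (hyz : y ≠ z) : c s(x, y) ≠ c s(y, z) := by
  intro heq
  have := (h.resolve_left hxy).2 s(y, z) (by simpa using hyz) heq.symm
  simp [hxy, hxz] at this

/-- Any two consecutive edges of the walk have different colours. -/
def ProperWalk (c : EdgeColouring α) : List α → Prop
  | x :: y :: z :: l => c s(x, y) ≠ c s(y, z) ∧ ProperWalk c (y :: z :: l)
  | _ => True

/-- Any two consecutive edges of the closed walk have different colours. -/
def ProperCycle (c : EdgeColouring α) (l : List α) : Prop :=
  ProperWalk c (l ++ l.take 2)

lemma ProperWalk.tail {x : α} {l : List α} (h : ProperWalk c (x :: l)) : ProperWalk c l := by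
  match l, h with
  | [], _ => trivial
  | [_], _ => trivial
  | _ :: _ :: _, h => exact h.2

lemma ProperWalk.of_append_left {l₁ l₂ : List α} (h : ProperWalk c (l₁ ++ l₂)) :
    ProperWalk c l₁ := by
  induction l₁ with
  | nil => trivial
  | cons x l ih =>
    match l, ih, h with
    | [], _, _ => trivial
    | [_], _, _ => trivial
    | _ :: _ :: _, ih, h => exact ⟨h.1, ih h.2⟩

lemma ProperWalk.append {x y : α} {l₁ l₂ : List α} (h₁ : ProperWalk c (l₁ ++ [x, y]))
    (h₂ : ProperWalk c (x :: y :: l₂)) : ProperWalk c (l₁ ++ x :: y :: l₂) := by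
  induction l₁ with
  | nil => exact h₂
  | cons z l ih =>
    match l, ih, h₁ with
    | [], _, h₁ => exact ⟨h₁.1, h₂⟩
    | [_], ih, h₁ => exact ⟨h₁.1, ih h₁.2⟩
    | _ :: _ :: _, ih, h₁ => exact ⟨h₁.1, ih h₁.2⟩

lemma ProperCycle.rotate_one {a : α} {l : List α} (hl : 2 ≤ l.length)
    (h : ProperCycle c (a :: l)) : ProperCycle c (l ++ [a]) := by
  match l, hl with
  | b :: d :: t, _ =>
    have h' : ProperWalk c (a :: b :: d :: (t ++ [a, b])) := by simpa [ProperCycle] using h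
    have := ProperWalk.append (l₁ := b :: d :: t) (x := a) (y := b) (l₂ := [d])
      (by simpa using h'.2) ⟨h'.1, trivial⟩
    simpa [ProperCycle] using this

lemma ProperCycle.rotate {l₁ l₂ : List α} (hl : 3 ≤ (l₁ ++ l₂).length)
    (h : ProperCycle c (l₁ ++ l₂)) : ProperCycle c (l₂ ++ l₁) := by
  induction l₁ generalizing l₂ with
  | nil => simpa using h
  | cons a l ih =>
    have := ih (l₂ := l₂ ++ [a]) (by simp at hl ⊢; omega) (by
      rw [← List.append_assoc]
      exact h.rotate_one (by simp at hl ⊢; omega))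
    simpa using this

lemma properWalk_of_isChain {b d : α} {l : List α} (hc : (l ++ [b]).IsChain (Dominates c))
    (hn : (l ++ [b, d]).Nodup) : ProperWalk c (l ++ [b, d]) := by
  induction l with
  | nil => trivial
  | cons x l ih =>
    match l, ih, hc, hn with
    | [], _, hc, hn =>
      simp at hc hn
      exact ⟨hc.colour_ne (by tauto) (by tauto) (by tauto), trivial⟩
    | [y], ih, hc, hn =>
      simp at hc hn
      refine ⟨hc.1.colour_ne (by tauto) (by tauto) (by tauto), ih ?_ ?_⟩
      · simpa using hc.2
      · simp; tauto
    | y :: z :: s, ih, hc, hn =>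
      rw [List.cons_append, List.cons_append, List.isChain_cons_cons] at hc
      have hn' := hn
      simp at hn
      refine ⟨hc.1.colour_ne (by tauto) (by tauto) (by tauto), ih hc.2 ?_⟩
      exact (List.nodup_cons.1 hn').2

lemma properCycle_of_isChain {x : α} {t : List α} (hn : (x :: t).Nodup) (hl : 2 ≤ t.length)
    (hc : (x :: (t ++ [x])).IsChain (Dominates c)) : ProperCycle c (x :: t) := by
  match t, hl with
  | y :: z :: s, _ =>
    obtain ⟨r, w, hr⟩ : ∃ r w, z :: s = r ++ [w] :=
      ⟨_, _, (List.dropLast_append_getLast (List.cons_ne_nil z s)).symm⟩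
    have hc' : (x :: y :: z :: (s ++ [x])).IsChain (Dominates c) := by simpa using hc
    have hsplit : x :: y :: z :: (s ++ [x]) = x :: y :: (r ++ [w, x]) := by
      have : z :: (s ++ [x]) = (z :: s) ++ [x] := rfl
      rw [this, hr]; simp
    have hn0 := hn
    have hn1 := hn
    rw [hr] at hn1
    simp at hn hn1
    have hcw : Dominates c w x := by
      rw [hsplit] at hc'
      have : (x :: y :: r ++ [w, x]).IsChain (Dominates c) := by simpa using hc'
      have := this.right_of_append
      simpa using this
    have h1 : ProperWalk c (y :: r ++ [w, x]) := by
      apply properWalk_of_isChain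
      · rw [hsplit] at hc'
        have : ((x :: y :: r ++ [w]) ++ [x]).IsChain (Dominates c) := by simpa using hc'
        exact this.left_of_append.tail
      · have : (y :: r ++ [w, x]).Perm (x :: y :: z :: s) := by
          rw [hr]
          have : y :: r ++ [w, x] = (y :: (r ++ [w])) ++ [x] := by simp
          rw [this]
          exact List.perm_append_singleton _ _
        exact this.nodup_iff.2 hn0
    have h2 : ProperWalk c ((x :: y :: r) ++ [w, x]) := by
      have h2 : ProperWalk c (x :: y :: z :: (s ++ [x])) := by
        refine ⟨?_, ?_⟩
        · rw [List.isChain_cons_cons] at hc'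
          exact hc'.1.colour_ne (by tauto) (by tauto) (by tauto)
        · rw [List.cons.injEq] at hsplit
          rw [hsplit.2]
          simpa using h1
      rw [hsplit] at h2
      simpa using h2
    have h3 := h2.append (l₂ := [y]) ⟨hcw.colour_ne (by tauto) (by tauto) (by tauto), trivial⟩
    have : ProperCycle c (x :: y :: (z :: s)) := by
      rw [hr]
      simpa [ProperCycle] using h3
    exact this

lemma ProperCycle.extend {a b p : α} {m t : List α} (hm : m ≠ [])
    (h : ProperCycle c (b :: m ++ [a])) (hn : (b :: m ++ [a] ++ p :: t).Nodup)
    (hc : (p :: t).IsChain (Dominates c))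
    (hd : ∀ x ∈ p :: t, ∀ y ∈ b :: m ++ [a], Dominates c x y)
    (hp : ∀ q s, t ++ [b] = q :: s → c s(p, a) ≠ c s(p, q)) :
    ProperCycle c (b :: m ++ [a] ++ p :: t) := by
  obtain ⟨r, w, rfl⟩ : ∃ r w, m = r ++ [w] :=
    ⟨_, _, (List.dropLast_append_getLast hm).symm⟩
  obtain ⟨d, s, hds⟩ : ∃ d s, r ++ [w] = d :: s := by
    cases r <;> simp
  have hnd : (p :: t ++ [b, d]).Nodup := by
    rw [hds] at hn
    have := (List.perm_append_comm.nodup_iff).1 hn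
    refine this.sublist ?_
    refine List.Sublist.append_left ?_ _
    simp
  have h1 : ProperWalk c (p :: t ++ [b, d]) := by
    refine properWalk_of_isChain ?_ hnd
    rw [List.isChain_append]
    refine ⟨hc, by simp, fun x hx y hy => ?_⟩
    obtain rfl : b = y := by simpa using hy
    exact hd x (List.mem_of_mem_getLast? hx) _ (by simp)
  obtain ⟨q, u, hqu⟩ : ∃ q u, t ++ [b] = q :: u := by
    cases t <;> simp
  have h2 : ProperWalk c (w :: a :: (p :: t ++ [b, d])) := by
    have hnp : p ≠ a ∧ p ≠ w ∧ a ≠ w := by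
      simp at hn
      grind
    refine ⟨?_, ?_⟩
    · have := (hd p (by simp) a (by simp)).colour_ne hnp.1 hnp.2.1 hnp.2.2
      rw [Sym2.eq_swap, Sym2.eq_swap (a := a) (b := p)]
      exact this.symm
    · have e : p :: t ++ [b, d] = p :: q :: (u ++ [d]) := by
        have : p :: t ++ [b, d] = p :: (t ++ [b]) ++ [d] := by simp
        rw [this, hqu]; simp
      change ProperWalk c (a :: (p :: t ++ [b, d]))
      rw [e] at h1 ⊢
      refine ⟨?_, h1⟩
      rw [Sym2.eq_swap]
      exact hp q u hqu
  have h3 : ProperWalk c (b :: r ++ [w, a]) := by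
    have := ProperWalk.of_append_left h
    simpa using this
  have h4 := h3.append h2
  have e : (b :: (r ++ [w]) ++ [a] ++ p :: t).take 2 = [b, d] := by rw [hds]; simp
  unfold ProperCycle
  rw [e]
  simpa using h4

lemma exists_adjacent_ne {β : Type*} (g : α → β) (l : List α) {x y : α} (hx : x ∈ l)
    (hy : y ∈ l) (h : g x ≠ g y) : ∃ l₁ a b l₂, l = l₁ ++ a :: b :: l₂ ∧ g a ≠ g b := by
  by_contra! hcon
  have : ∀ l' l₀ z, l = l₀ ++ z :: l' → ∀ u ∈ z :: l', g u = g z := by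
    intro l'
    induction l' with
    | nil => simp
    | cons z' l' ih =>
      intro l₀ z hl u hu
      have h1 := ih (l₀ ++ [z]) z' (by simpa using hl)
      rcases List.mem_cons.1 hu with rfl | hu
      · rfl
      · rw [h1 u hu, hcon _ _ _ _ hl]
  cases l with
  | nil => simp at hx
  | cons z l => exact h ((this l [] z rfl x hx).trans (this l [] z rfl y hy).symm)

lemma ProperWalk.getElem {l : List α} (h : ProperWalk c l) (i : ℕ) (hi : i + 2 < l.length) :
    c s(l[i], l[i + 1]) ≠ c s(l[i + 1], l[i + 2]) := by
  induction i generalizing l with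
  | zero =>
    match l, h, hi with
    | _ :: _ :: _ :: _, h, _ => exact h.1
  | succ i ih =>
    match l, h, hi with
    | _ :: l, h, hi => exact ih h.tail (by rw [List.length_cons] at hi; omega)

/-- `v` is a centre of two colour classes meeting `v`'s neighbourhood in `U`. -/
def HasTwoCentresIn (c : EdgeColouring α) (U : Finset α) (v : α) : Prop :=
  ∃ u₁ ∈ U, ∃ u₂ ∈ U, u₁ ≠ v ∧ u₂ ≠ v ∧ Dominates c v u₁ ∧ Dominates c v u₂ ∧
    c s(v, u₁) ≠ c s(v, u₂)

lemma hasTwoCentresIn_univ [Fintype α] {v : α} {m₁ m₂ : ℕ} (hm : m₁ ≠ m₂)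
    (h₁ : IsCentre c v m₁) (h₂ : IsCentre c v m₂) : HasTwoCentresIn c Finset.univ v := by
  have key : ∀ m, IsCentre c v m → ∃ u, u ≠ v ∧ Dominates c v u ∧ c s(v, u) = m := by
    rintro m h
    obtain ⟨e, he, rfl, hve⟩ := h.1
    obtain ⟨u, rfl⟩ := Sym2.mem_iff_exists.1 hve
    exact ⟨u, by simpa [eq_comm] using he, Or.inr h, rfl⟩
  obtain ⟨u₁, k₁, d₁, rfl⟩ := key m₁ h₁
  obtain ⟨u₂, k₂, d₂, rfl⟩ := key m₂ h₂
  exact ⟨u₁, Finset.mem_univ _, u₂, Finset.mem_univ _, k₁, k₂, d₁, d₂, hm⟩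

/-- No vertex of `W` is a centre of the colour class of an edge leaving `W`. -/
def IsClosed (c : EdgeColouring α) (W : Finset α) : Prop :=
  ∀ x ∈ W, ∀ y, y ∉ W → ¬ Dominates c x y

variable [DecidableEq α]

/-- The set `W` is the vertex set of a properly coloured cycle. -/
def HasProperCycleOn (c : EdgeColouring α) (W : Finset α) : Prop :=
  ∃ l : List α, l.Nodup ∧ l.toFinset = W ∧ 3 ≤ l.length ∧ ProperCycle c l

lemma hasProperCycleOn_of_strong (hc : IsStarColouring c) {S : Finset α} (hne : S.Nonempty)
    (hS : ∀ w ∈ S, IsRoot (Dominates c) S w) (hv : ∀ v ∈ S, HasTwoCentresIn c S v) :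
    HasProperCycleOn c S := by
  obtain ⟨x, t, hn, hU, hch⟩ := exists_directed_cycle (dominates_total hc) hne hS
  have hcard : 3 ≤ S.card := by
    obtain ⟨v, hvS⟩ := hne
    obtain ⟨u₁, h₁, u₂, h₂, h₃, h₄, -, -, h₅⟩ := hv v hvS
    have h12 : u₁ ≠ u₂ := by rintro rfl; exact h₅ rfl
    rw [← Finset.card_eq_three.2 ⟨v, u₁, u₂, h₃.symm, h₄.symm, h12, rfl⟩]
    refine Finset.card_le_card ?_
    intro z hz
    simp only [Finset.mem_insert, Finset.mem_singleton] at hz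
    rcases hz with rfl | rfl | rfl <;> assumption
  have hlen : 3 ≤ (x :: t).length := by
    rw [← List.toFinset_card_of_nodup hn, hU]; exact hcard
  exact ⟨x :: t, hn, hU, hlen, properCycle_of_isChain hn (by simpa using hlen) hch⟩

lemma HasProperCycleOn.union (hc : IsStarColouring c) {W S : Finset α}
    (hW : HasProperCycleOn c W) (hdisj : Disjoint W S) (hne : S.Nonempty)
    (hdom : ∀ x ∈ S, ∀ y ∈ W, Dominates c x y)
    (hS : ∀ w ∈ S, IsRoot (Dominates c) S w) (hv : ∀ v ∈ S, HasTwoCentresIn c (W ∪ S) v) :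
    HasProperCycleOn c (W ∪ S) := by
  obtain ⟨L, hLn, rfl, hL3, hLc⟩ := hW
  have finish : ∀ (l₁ l₂ : List α) (a b p : α) (t : List α), L = l₁ ++ l₂ →
      (∃ m, l₂ ++ l₁ = b :: m ++ [a]) → (p :: t).Nodup → (p :: t).toFinset = S →
      (p :: t).IsChain (Dominates c) →
      (∀ q s, t ++ [b] = q :: s → c s(p, a) ≠ c s(p, q)) →
      HasProperCycleOn c (L.toFinset ∪ S) := by
    rintro l₁ l₂ a b p t rfl ⟨m, hm⟩ hn rfl hch hp
    have hperm : (l₁ ++ l₂).Perm (b :: m ++ [a]) := hm ▸ List.perm_append_comm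
    have hmem : ∀ y, y ∈ b :: m ++ [a] ↔ y ∈ l₁ ++ l₂ := fun y => hperm.mem_iff.symm
    have hm0 : m ≠ [] := by
      rintro rfl
      have := hperm.length_eq
      simp at this hL3
      omega
    have hnod : (b :: m ++ [a] ++ p :: t).Nodup := by
      refine List.Nodup.append (hperm.nodup_iff.1 hLn) hn ?_
      rw [List.disjoint_toFinset_iff_disjoint] at hdisj
      intro z hz
      exact hdisj ((hmem z).1 hz)
    refine ⟨b :: m ++ [a] ++ p :: t, hnod, ?_, ?_, ?_⟩
    · rw [List.toFinset_append, List.toFinset_eq_of_perm _ _ hperm]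
    · rw [List.length_append, ← hperm.length_eq]; omega
    · refine ProperCycle.extend hm0 (hm ▸ hLc.rotate hL3) hnod hch ?_ hp
      intro x hx y hy
      exact hdom x (by simpa using hx) y (by simpa using (hmem y).1 hy)
  have rot : ∀ a ∈ L, ∃ l₁ l₂ b, L = l₁ ++ l₂ ∧ ∃ m, l₂ ++ l₁ = b :: m ++ [a] := by
    intro a ha
    obtain ⟨l₁, l₂, rfl⟩ := List.append_of_mem ha
    have : l₂ ++ l₁ ≠ [] := by
      intro h
      have := congrArg List.length h
      simp only [List.length_append, List.length_cons, List.length_nil] at this hL3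
      omega
    obtain ⟨b, m, hbm⟩ := List.exists_cons_of_ne_nil this
    exact ⟨l₁ ++ [a], l₂, b, by simp, m, by rw [← hbm]; simp⟩
  by_cases hA : ∃ v ∈ S, ∃ a₁ ∈ L, ∃ a₂ ∈ L, c s(v, a₁) ≠ c s(v, a₂)
  · obtain ⟨v, hvS, a₁, h₁, a₂, h₂, hne12⟩ := hA
    obtain ⟨t, hn, hU, hch⟩ := (hS v hvS).exists_path (dominates_total hc) hvS
    cases t with
    | nil =>
      obtain ⟨l₁, a, b, l₂, hl, hab⟩ := exists_adjacent_ne (fun z => c s(v, z)) L h₁ h₂ hne12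
      refine finish (l₁ ++ [a]) (b :: l₂) a b v [] (by simpa using hl)
        ⟨l₂ ++ l₁, by simp⟩ hn hU hch ?_
      intro q s hqs
      obtain ⟨rfl, -⟩ : b = q ∧ [] = s := by simpa using hqs
      exact hab
    | cons p₂ t =>
      obtain ⟨a, ha, hav⟩ : ∃ a ∈ L, c s(v, a) ≠ c s(v, p₂) := by
        by_contra! h
        exact hne12 ((h a₁ h₁).trans (h a₂ h₂).symm)
      obtain ⟨l₁, l₂, b, hl, hm⟩ := rot a ha
      refine finish l₁ l₂ a b v (p₂ :: t) hl hm hn hU hch ?_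
      intro q s hqs
      obtain ⟨rfl, -⟩ : p₂ = q ∧ t ++ [b] = s := by simpa using hqs
      exact hav
  · push Not at hA
    obtain ⟨a, ha⟩ : ∃ a, a ∈ L := List.exists_mem_of_length_pos (by omega)
    have hf : ∀ v, ∃ w, v ∈ S → w ∈ S ∧ w ≠ v ∧ Dominates c v w ∧ c s(v, a) ≠ c s(v, w) := by
      intro v
      by_cases hvS : v ∈ S
      · obtain ⟨u₁, h₁, u₂, h₂, h₃, h₄, h₅, h₆, h₇⟩ := hv v hvS
        have hS' : ∀ u ∈ L.toFinset ∪ S, c s(v, a) ≠ c s(v, u) → u ∈ S := by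
          intro u hu hne
          rw [Finset.mem_union, List.mem_toFinset] at hu
          exact hu.resolve_left fun h => hne (hA v hvS a ha u h)
        by_cases h : c s(v, a) = c s(v, u₁)
        · have h' : c s(v, a) ≠ c s(v, u₂) := h ▸ h₇
          exact ⟨u₂, fun _ => ⟨hS' u₂ h₂ h', h₄, h₆, h'⟩⟩
        · exact ⟨u₁, fun _ => ⟨hS' u₁ h₁ h, h₃, h₅, h⟩⟩
      · exact ⟨v, fun h => absurd h hvS⟩
    choose f hf using hf
    obtain ⟨v, hvS, hroot⟩ := exists_isRoot_erase (dominates_total hc) hne hS f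
      (fun v h => (hf v h).1) (fun v h => (hf v h).2.2.1)
    obtain ⟨hfS, hfv, hfd, hfc⟩ := hf v hvS
    obtain ⟨t, hn, hU, hch⟩ := hroot.exists_path (dominates_total hc)
      (Finset.mem_erase.2 ⟨hfv, hfS⟩)
    obtain ⟨l₁, l₂, b, hl, hm⟩ := rot a ha
    refine finish l₁ l₂ a b v (f v :: t) hl hm (List.nodup_cons.2 ⟨?_, hn⟩) ?_ ?_ ?_
    · rw [← List.mem_toFinset, hU]; simp
    · rw [List.toFinset_cons, hU, Finset.insert_erase hvS]
    · exact List.isChain_cons_cons.2 ⟨hfd, hch⟩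
    · intro q s hqs
      obtain ⟨rfl, -⟩ : f v = q ∧ t ++ [b] = s := by simpa using hqs
      exact hfc

lemma hasProperCycleOn_univ [Fintype α] [Nonempty α] (hc : IsStarColouring c)
    (hv : ∀ v, HasTwoCentresIn c Finset.univ v) : HasProperCycleOn c Finset.univ := by
  classical
  have huniv : IsClosed c (Finset.univ : Finset α) := fun x _ y hy => absurd (Finset.mem_univ y) hy
  obtain ⟨W, hWmax⟩ := (Set.toFinite
    {W : Finset α | IsClosed c W ∧ (W = ∅ ∨ HasProperCycleOn c W)}).exists_maximal
    ⟨∅, by simp [IsClosed]⟩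
  obtain ⟨hWc, hW⟩ := hWmax.prop
  by_cases hWu : W = Finset.univ
  · subst hWu
    exact hW.resolve_left Finset.univ_nonempty.ne_empty
  obtain ⟨V, hVmin⟩ := (Set.toFinite {V : Finset α | IsClosed c V ∧ W ⊂ V}).exists_minimal
    ⟨Finset.univ, huniv, Finset.ssubset_univ_iff.2 hWu⟩
  obtain ⟨hVc, hWV⟩ := hVmin.prop
  obtain ⟨S, hSV, hdisj⟩ : ∃ S, W ∪ S = V ∧ Disjoint W S :=
    ⟨V \ W, Finset.union_sdiff_of_subset hWV.1, Finset.disjoint_sdiff⟩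
  subst hSV
  have hne : S.Nonempty := by
    rw [Finset.nonempty_iff_ne_empty]
    rintro rfl
    simp at hWV
  have hS : ∀ w ∈ S, IsRoot (Dominates c) S w := by
    intro w hw X hX hwX hXS
    by_contra! hcon
    have hcl : IsClosed c (W ∪ X) := by
      intro x hx y hy hxy
      rw [Finset.mem_union, not_or] at hy
      rcases Finset.mem_union.1 hx with hx | hx
      · exact hWc x hx y hy.1 hxy
      · by_cases hyS : y ∈ S
        · exact hcon x hx y hyS hy.2 hxy
        · exact hVc x (Finset.mem_union_right _ (hX hx)) y (by simp [hy.1, hyS]) hxy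
    have hlt : W ⊂ W ∪ X := by
      refine ⟨Finset.subset_union_left, fun h => ?_⟩
      exact Finset.disjoint_left.1 hdisj (h (Finset.mem_union_right _ hwX)) hw
    have hle : W ∪ S ⊆ W ∪ X := hVmin.le_of_le ⟨hcl, hlt⟩
      (Finset.union_subset_union_right hX)
    refine hXS (hX.antisymm fun z hz => ?_)
    exact (Finset.mem_union.1 (hle (Finset.mem_union_right _ hz))).resolve_left
      fun h => Finset.disjoint_left.1 hdisj h hz
  have hv' : ∀ v ∈ S, HasTwoCentresIn c (W ∪ S) v := by
    intro v hvS
    obtain ⟨u₁, -, u₂, -, h₃, h₄, h₅, h₆, h₇⟩ := hv v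
    have : ∀ u, Dominates c v u → u ∈ W ∪ S := fun u hu => by
      by_contra h
      exact hVc v (Finset.mem_union_right _ hvS) u h hu
    exact ⟨u₁, this _ h₅, u₂, this _ h₆, h₃, h₄, h₅, h₆, h₇⟩
  have hVcyc : HasProperCycleOn c (W ∪ S) := by
    rcases hW with rfl | hW
    · rw [Finset.empty_union] at hv' ⊢
      exact hasProperCycleOn_of_strong hc hne hS hv'
    · refine hW.union hc hdisj hne (fun x hx y hy => ?_) hS hv'
      exact (dominates_total hc x y).resolve_right
        (hWc y hy x (Finset.disjoint_right.1 hdisj hx))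
  exact absurd (hWmax.le_of_ge ⟨hVc, Or.inr hVcyc⟩ hWV.1) hWV.2

end Colouring

lemma exists_eq_of_cycleGraph_adj {n : ℕ} [NeZero n] {u v : Fin n}
    (h : (SimpleGraph.cycleGraph n).Adj u v) :
    ∃ k : Fin n, s(u, v) = s(k, k + 1) := by
  rw [SimpleGraph.cycleGraph_adj'] at h
  have key : ∀ a b : Fin n, (a - b).val = 1 → a = b + 1 := by
    intro a b hab
    have h1 : 1 < n := hab ▸ (a - b).isLt
    have : a - b = 1 := by
      apply Fin.ext
      rw [hab, Fin.val_one', Nat.mod_eq_of_lt h1]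
    rw [← this]; abel
  rcases h with h | h
  · exact ⟨v, by rw [key _ _ h, Sym2.eq_swap]⟩
  · exact ⟨u, by rw [key _ _ h]⟩

/-- In a star-colouring a properly coloured Hamilton cycle is rainbow. -/
lemma hasRainbowCopy_cycleGraph {α : Type*} {c : EdgeColouring α} (hc : IsStarColouring c)
    {l : List α} (hn : l.Nodup) (hl : 3 ≤ l.length) (h : ProperCycle c l) :
    HasRainbowCopy c (SimpleGraph.cycleGraph l.length) := by
  have : NeZero l.length := ⟨by omega⟩
  have hinj : Function.Injective l.get := List.nodup_iff_injective_get.1 hn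
  have hone : (1 : Fin l.length) ≠ 0 := by
    intro h
    have := congrArg Fin.val h
    rw [Fin.val_one', Nat.mod_eq_of_lt (by omega)] at this
    simp at this
  have hprop : ∀ k : Fin l.length,
      c s(l.get k, l.get (k + 1)) ≠ c s(l.get (k + 1), l.get (k + 1 + 1)) := by
    intro k
    have hlen : (l ++ l.take 2).length = l.length + 2 := by simp; omega
    have hget : ∀ (i : ℕ) (hi : i < (l ++ l.take 2).length) (j : Fin l.length),
        j.val = i % l.length → (l ++ l.take 2)[i] = l.get j := by
      rintro i hi j hj
      rw [List.get_eq_getElem, List.getElem_append]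
      split
      · rename_i h
        simp [hj, Nat.mod_eq_of_lt h]
      · rename_i h
        have : i % l.length = i - l.length := by
          rw [Nat.mod_eq_sub_mod (by omega), Nat.mod_eq_of_lt (by omega)]
        simp [hj, this]
    have hk := k.isLt
    have := ProperWalk.getElem h k.val (by omega)
    rw [hget k.val (by omega) k (Nat.mod_eq_of_lt hk).symm,
      hget (k.val + 1) (by omega) (k + 1) (by simp [Fin.val_add]),
      hget (k.val + 2) (by omega) (k + 1 + 1) (by simp [Fin.val_add, Nat.add_assoc])] at this
    exact this
  refine ⟨⟨l.get, hinj⟩, fun u v x y huv hxy hne => ?_⟩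
  obtain ⟨j, hj⟩ := exists_eq_of_cycleGraph_adj huv
  obtain ⟨k, hk⟩ := exists_eq_of_cycleGraph_adj hxy
  have e1 : s(l.get u, l.get v) = s(l.get j, l.get (j + 1)) := by
    simpa using congrArg (Sym2.map l.get) hj
  have e2 : s(l.get x, l.get y) = s(l.get k, l.get (k + 1)) := by
    simpa using congrArg (Sym2.map l.get) hk
  simp only [Function.Embedding.coeFn_mk]
  rw [e1, e2]
  have hjk : j ≠ k := by
    rintro rfl
    exact hne (hj.trans hk.symm)
  have hsucc : ∀ i : Fin l.length, l.get i ≠ l.get (i + 1) := fun i h =>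
    hone (by simpa using hinj h)
  intro heq
  rcases hc.1 _ _ _ _ (hsucc j) (hsucc k) heq with h | h | h | h
  · exact hjk (hinj h)
  · obtain rfl := hinj h
    exact hprop k heq.symm
  · obtain rfl := hinj h
    exact hprop j heq
  · exact hjk (by simpa using hinj h)

end StarColouring

/-- Let `n ≥ 3` and let `c` be a star-colouring of `K_n`. If every vertex is a centre
of at least two colour classes, then `c` has a rainbow Hamilton cycle `C_n`. -/
theorem rainbow_hamilton_of_two_centres (n : ℕ) (hn : 3 ≤ n)
    (c : EdgeColouring (Fin n)) (hc : IsStarColouring c)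
    (hv : ∀ v : Fin n, ∃ m₁ m₂ : ℕ, m₁ ≠ m₂ ∧ IsCentre c v m₁ ∧ IsCentre c v m₂) :
    HasRainbowCopy c (SimpleGraph.cycleGraph n) := by
  have : Nonempty (Fin n) := ⟨⟨0, by omega⟩⟩
  obtain ⟨l, hn', hU, hl, hcyc⟩ := StarColouring.hasProperCycleOn_univ hc fun v => by
    obtain ⟨m₁, m₂, hm, h₁, h₂⟩ := hv v
    exact StarColouring.hasTwoCentresIn_univ hm h₁ h₂
  have hlen : l.length = n := by
    rw [← List.toFinset_card_of_nodup hn', hU, Finset.card_univ, Fintype.card_fin]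
  have := StarColouring.hasRainbowCopy_cycleGraph hc hn' hl hcyc
  rwa [hlen] at this
end

section
/- Let T_1 and T_2 be trees on s and t vertices respectively, with s, t ≥ 3, and let F be a subgraph of the join T_1 + T_2 which is a forest. Then the graph (T_1 + T_2) with the edges of F removed either contains an odd cycle or contains K_{s,t}^- as a subgraph. -/
open SimpleGraph

namespace SimpleGraph

/-- A closed walk of odd length yields an odd cycle subgraph. -/
theorem containsCopy_odd_cycleGraph {V : Type*} {G : SimpleGraph V} (n : ℕ) (hn : Odd n) :
    ∀ (v : V) (p : G.Walk v v), p.length = n →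
      ∃ k : ℕ, 3 ≤ k ∧ Odd k ∧ ContainsCopy (cycleGraph k) G := by
  induction n using Nat.strong_induction_on with
  | _ n ih =>
  intro v p hp
  by_cases hinj : ∃ i j, i < j ∧ j < n ∧ p.getVert i = p.getVert j
  · obtain ⟨i, j, hij, hj, he⟩ := hinj
    have hinner : ((p.drop i).take (j - i)).length = j - i := by
      simp [hp]; omega
    have hend : (p.drop i).getVert (j - i) = p.getVert i := by
      rw [Walk.drop_getVert, he]; congr 1; omega
    by_cases hodd : Odd (j - i)
    · exact ih (j - i) (by omega) hodd _ (((p.drop i).take (j - i)).copy rfl hend)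
        (by rw [Walk.length_copy, hinner])
    · refine ih (n - (j - i)) (by omega) (by grind) v
        (((p.take i).copy rfl he).append (p.drop j)) ?_
      simp [hp]; omega
  · have hn1 : n ≠ 1 := by
      rintro rfl
      have := p.adj_getVert_succ (i := 0) (by omega)
      have hl := p.getVert_length
      rw [hp] at hl
      simp [hl] at this
    have hn3 : 3 ≤ n := by grind
    refine ⟨n, hn3, hn, ⟨fun i => p.getVert i, fun i j hij => ?_⟩, ?_⟩
    · by_contra hne
      rcases lt_or_gt_of_ne hne with h | h
      · exact hinj ⟨i, j, h, j.2, hij⟩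
      · exact hinj ⟨j, i, h, i.2, hij.symm⟩
    · have key : ∀ u w : Fin n, (u - w).val = 1 → G.Adj (p.getVert w) (p.getVert u) := by
        intro u w h
        have hadj := p.adj_getVert_succ (i := w) (by omega)
        rw [Fin.val_sub] at h
        have hu := u.2
        have hw := w.2
        rcases Nat.lt_or_ge (n - w.val + u.val) n with hlt | hge
        · rw [Nat.mod_eq_of_lt hlt] at h
          have hw' : w.val + 1 = p.length := by omega
          have hu' : u.val = 0 := by omega
          rw [hw', Walk.getVert_length] at hadj
          rwa [hu', Walk.getVert_zero]
        · rw [Nat.mod_eq_sub_mod hge, Nat.mod_eq_of_lt (by omega)] at h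
          rwa [show w.val + 1 = u.val by omega] at hadj
      intro u w h
      rcases cycleGraph_adj'.1 h with h | h
      · exact (key u w h).symm
      · exact key w u h

theorem colorable_two_or_contains_odd_cycle {V : Type*} (G : SimpleGraph V) :
    G.Colorable 2 ∨ ∃ k : ℕ, 3 ≤ k ∧ Odd k ∧ ContainsCopy (cycleGraph k) G := by
  rw [two_colorable_iff_forall_loop_even, or_iff_not_imp_left]
  intro h
  push Not at h
  obtain ⟨v, p, hp⟩ := h
  exact containsCopy_odd_cycleGraph _ (by simpa using hp) v p rfl

theorem IsAcyclic.not_reachable_deleteEdges {V : Type*} {F : SimpleGraph V} (hF : F.IsAcyclic)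
    {a b : V} (hab : F.Adj a b) : ¬ (F.deleteEdges {s(a, b)}).Reachable a b :=
  isBridge_iff.1 (isAcyclic_iff_forall_adj_isBridge.1 hF hab)

theorem IsAcyclic.not_triangle {V : Type*} {F : SimpleGraph V} (hF : F.IsAcyclic)
    {a b c : V} (hab : F.Adj a b) (hbc : F.Adj b c) (hca : F.Adj c a) : False := by
  apply hF.not_reachable_deleteEdges hab
  have h₁ : (F.deleteEdges {s(a, b)}).Adj a c := by
    have := hbc.ne; have := hca.ne; have := hab.ne
    simp [hca.symm]; grind
  have h₂ : (F.deleteEdges {s(a, b)}).Adj c b := by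
    have := hbc.ne; have := hca.ne; have := hab.ne
    simp [hbc.symm]; grind
  exact h₁.reachable.trans h₂.reachable

theorem IsAcyclic.not_four_cycle {V : Type*} {F : SimpleGraph V} (hF : F.IsAcyclic)
    {a b x y : V} (hne : a ≠ b) (hne' : x ≠ y) (hax : F.Adj a x) (hay : F.Adj a y)
    (hbx : F.Adj b x) (hby : F.Adj b y) : False := by
  apply hF.not_reachable_deleteEdges hax
  have := hax.ne; have := hay.ne; have := hbx.ne; have := hby.ne
  have h₁ : (F.deleteEdges {s(a, x)}).Adj a y := by
    simp [hay]; grind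
  have h₂ : (F.deleteEdges {s(a, x)}).Adj y b := by
    simp [hby.symm]; grind
  have h₃ : (F.deleteEdges {s(a, x)}).Adj b x := by
    simp [hbx]; grind
  exact (h₁.reachable.trans h₂.reachable).trans h₃.reachable

end SimpleGraph

theorem graphJoin_adj_inl {α β : Type*} {G : SimpleGraph α} {H : SimpleGraph β} {a b : α} :
    (graphJoin G H).Adj (.inl a) (.inl b) ↔ G.Adj a b := by
  simp [graphJoin, G.adj_comm b a]
  exact fun h => h.ne

theorem graphJoin_adj_inr {α β : Type*} {G : SimpleGraph α} {H : SimpleGraph β} {a b : β} :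
    (graphJoin G H).Adj (.inr a) (.inr b) ↔ H.Adj a b := by
  simp [graphJoin, H.adj_comm b a]
  exact fun h => h.ne

theorem graphJoin_adj_inl_inr {α β : Type*} {G : SimpleGraph α} {H : SimpleGraph β}
    (a : α) (b : β) : (graphJoin G H).Adj (.inl a) (.inr b) := by
  simp [graphJoin]

/-- A copy of `K_{s,t}` with at most one edge missing contains `K_{s,t}^-`. -/
theorem containsCopy_Kstminus {V : Type*} {G : SimpleGraph V} {s t : ℕ} (hs : 0 < s) (ht : 0 < t)
    (f : Fin s ⊕ Fin t ↪ V)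
    (h : ∀ i j i' j', ¬ G.Adj (f (.inl i)) (f (.inr j)) → ¬ G.Adj (f (.inl i')) (f (.inr j')) →
      i = i' ∧ j = j') :
    ContainsCopy (Kstminus s t hs ht) G := by
  obtain ⟨i₀, j₀, h₀⟩ : ∃ i₀ j₀, ∀ i j, ¬ (i = i₀ ∧ j = j₀) →
      G.Adj (f (.inl i)) (f (.inr j)) := by
    by_cases hall : ∀ i j, G.Adj (f (.inl i)) (f (.inr j))
    · exact ⟨⟨0, hs⟩, ⟨0, ht⟩, fun i j _ => hall i j⟩
    · push Not at hall
      obtain ⟨i₀, j₀, h₀⟩ := hall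
      exact ⟨i₀, j₀, fun i j hij => by_contra fun hn => hij (h i j i₀ j₀ hn h₀)⟩
  let e : Fin s ⊕ Fin t ≃ Fin s ⊕ Fin t :=
    Equiv.sumCongr (Equiv.swap ⟨0, hs⟩ i₀) (Equiv.swap ⟨0, ht⟩ j₀)
  have key : ∀ i j, ¬ (i = ⟨0, hs⟩ ∧ j = ⟨0, ht⟩) →
      G.Adj (f (e (.inl i))) (f (e (.inr j))) := by
    intro i j hij
    refine h₀ _ _ fun hc => hij ⟨?_, ?_⟩
    · have := hc.1; rwa [Equiv.swap_apply_eq_iff, Equiv.swap_apply_right] at this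
    · have := hc.2; rwa [Equiv.swap_apply_eq_iff, Equiv.swap_apply_right] at this
  refine ⟨e.toEmbedding.trans f, ?_⟩
  rintro (i | j) (i' | j') hadj <;> simp [Kstminus] at hadj
  · exact key i j' (by simpa using hadj)
  · exact (key i' j fun h => hadj h.2 h.1).symm

/-- If the forest `F` is connected on both sides of a spanning complete bipartite subgraph of `J`,
then removing `F` from `J` leaves a copy of `K_{s,t}^-`. -/
theorem containsCopy_Kstminus_sdiff {V : Type*} {J F : SimpleGraph V} (hF : F.IsAcyclic)
    {s t : ℕ} (hs : 0 < s) (ht : 0 < t) (f : Fin s ⊕ Fin t ↪ V)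
    (hJ : ∀ i j, J.Adj (f (.inl i)) (f (.inr j)))
    (hl : (F.comap (f ∘ Sum.inl)).Preconnected) (hr : (F.comap (f ∘ Sum.inr)).Preconnected) :
    ContainsCopy (Kstminus s t hs ht) (J \ F) := by
  refine containsCopy_Kstminus hs ht f fun i j i' j' h h' => ?_
  have hij : F.Adj (f (.inl i)) (f (.inr j)) := by simpa [hJ] using h
  have hij' : F.Adj (f (.inl i')) (f (.inr j')) := by simpa [hJ] using h'
  by_contra hne
  set D := F.deleteEdges {s(f (.inl i), f (.inr j))}
  let gl : F.comap (f ∘ Sum.inl) →g D := ⟨f ∘ Sum.inl, fun {a b} hab => by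
    refine (deleteEdges_adj ..).2 ⟨hab, ?_⟩
    simp⟩
  let gr : F.comap (f ∘ Sum.inr) →g D := ⟨f ∘ Sum.inr, fun {a b} hab => by
    refine (deleteEdges_adj ..).2 ⟨hab, ?_⟩
    simp⟩
  have hD : D.Adj (f (.inl i')) (f (.inr j')) := by
    refine (deleteEdges_adj ..).2 ⟨hij', ?_⟩
    simp
    grind
  exact hF.not_reachable_deleteEdges hij
    ((((hl i i').map gl).trans hD.reachable).trans ((hr j' j).map gr))

/-- A graph with a vertex adjacent to all others is preconnected. -/
theorem SimpleGraph.preconnected_of_forall_adj {V : Type*} {G : SimpleGraph V} (u : V)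
    (h : ∀ v, v ≠ u → G.Adj u v) : G.Preconnected := by
  have hu : ∀ v, G.Reachable u v := fun v => by
    by_cases hv : v = u
    · exact hv ▸ Reachable.refl _
    · exact (h v hv).reachable
  exact fun a b => (hu a).symm.trans (hu b)

/-- In a preconnected graph, if all vertices but `u` are pairwise non-adjacent, then all of
them are adjacent to `u`. -/
theorem SimpleGraph.Preconnected.adj_of_compl_independent {V : Type*} {G : SimpleGraph V}
    (hG : G.Preconnected) (u : V) (h : ∀ x y, x ≠ u → y ≠ u → ¬ G.Adj x y) {v : V} (hv : v ≠ u) :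
    G.Adj v u := by
  have : Nontrivial V := ⟨v, u, hv⟩
  obtain ⟨y, hy⟩ := hG.exists_adj_of_nontrivial v
  by_cases hyu : y = u
  · exact hyu ▸ hy
  · exact absurd hy (h v y hv hyu)

/-- Let `T₁, T₂` be trees on `s, t ≥ 3` vertices and let `F` be a forest subgraph of
the join `T₁ + T₂`. Then `(T₁ + T₂) \ F` contains an odd cycle or a copy of
`K_{s,t}` minus an edge. -/
theorem join_minus_forest (s t : ℕ) (hs : 3 ≤ s) (ht : 3 ≤ t)
    (T₁ : SimpleGraph (Fin s)) (T₂ : SimpleGraph (Fin t))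
    (hT₁ : T₁.IsTree) (hT₂ : T₂.IsTree)
    (F : SimpleGraph (Fin s ⊕ Fin t)) (hF : F ≤ graphJoin T₁ T₂)
    (hFforest : F.IsAcyclic) :
    (∃ k : ℕ, 3 ≤ k ∧ Odd k ∧
      ContainsCopy (SimpleGraph.cycleGraph k) (graphJoin T₁ T₂ \ F)) ∨
    ContainsCopy (Kstminus s t (by omega) (by omega)) (graphJoin T₁ T₂ \ F) := by
  rcases colorable_two_or_contains_odd_cycle (graphJoin T₁ T₂ \ F) with hcol | hodd
  swap
  · exact .inl hodd
  right
  obtain ⟨c⟩ := hcol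
  have hmono : ∀ x y, (graphJoin T₁ T₂).Adj x y → c x = c y → F.Adj x y := by
    intro x y hxy hc
    by_contra hn
    exact c.valid ((sdiff_adj ..).2 ⟨hxy, hn⟩) hc
  have hl : ∀ x y, T₁.Adj x y → c (.inl x) = c (.inl y) → F.Adj (.inl x) (.inl y) :=
    fun x y h => hmono _ _ (graphJoin_adj_inl.2 h)
  have hr : ∀ x y, T₂.Adj x y → c (.inr x) = c (.inr y) → F.Adj (.inr x) (.inr y) :=
    fun x y h => hmono _ _ (graphJoin_adj_inr.2 h)
  have hlr : ∀ x y, c (.inl x) = c (.inr y) → F.Adj (.inl x) (.inr y) :=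
    fun x y => hmono _ _ (graphJoin_adj_inl_inr x y)
  have two : ∀ a b d : Fin 2, a ≠ b → d ≠ b → a = d := by decide
  have : Nontrivial (Fin s) := Fin.nontrivial_iff_two_le.2 (by omega)
  have : Nontrivial (Fin t) := Fin.nontrivial_iff_two_le.2 (by omega)
  obtain ⟨x, y, hxy, hcxy⟩ : ∃ x y : Fin s, x ≠ y ∧ c (.inl x) = c (.inl y) :=
    Fintype.exists_ne_map_eq_of_card_lt (fun x : Fin s => c (.inl x)) (by simp; omega)
  by_cases hw : ∃ w, c (.inr w) = c (.inl x)
  · obtain ⟨w, hw⟩ := hw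
    have hw' : ∀ j, j ≠ w → c (.inr j) ≠ c (.inl x) := fun j hj hc =>
      hFforest.not_four_cycle (a := .inl x) (b := .inl y) (x := .inr j) (y := .inr w)
        (by simpa) (by simpa) (hlr _ _ (by rw [hc])) (hlr _ _ (by rw [hw]))
        (hlr _ _ (by rw [hc, hcxy])) (hlr _ _ (by rw [hw, hcxy]))
    obtain ⟨u, hu⟩ : ∃ u, c (.inl u) ≠ c (.inl x) := by
      by_contra! hu
      obtain ⟨z, hz⟩ := hT₁.connected.preconnected.exists_adj_of_nontrivial x
      exact hFforest.not_triangle (hl x z hz (hu z).symm) (hlr z w (by rw [hu, hw]))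
        (hlr x w hw.symm).symm
    obtain ⟨j, hjw, j', hjw', hjj⟩ : ∃ j, j ≠ w ∧ ∃ j', j' ≠ w ∧ j ≠ j' := by
      have : 1 < ((Finset.univ : Finset (Fin t)).erase w).card := by simp; omega
      obtain ⟨j, hj, j', hj', h⟩ := Finset.one_lt_card.1 this
      exact ⟨j, by simpa using hj, j', by simpa using hj', h⟩
    have hur : ∀ j, j ≠ w → c (.inl u) = c (.inr j) := fun j hj => two _ _ _ hu (hw' j hj)
    have hu' : ∀ i, i ≠ u → c (.inl i) = c (.inr w) := by
      intro i hi
      by_contra hne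
      have hiu : c (.inl i) = c (.inl u) := two _ _ _ (hw ▸ hne) hu
      exact hFforest.not_four_cycle (a := .inl i) (b := .inl u) (x := .inr j) (y := .inr j')
        (by simpa) (by simpa) (hlr _ _ (by rw [hiu, hur j hjw]))
        (hlr _ _ (by rw [hiu, hur j' hjw']))
        (hlr _ _ (hur j hjw)) (hlr _ _ (hur j' hjw'))
    have hstar₁ : ∀ i, i ≠ u → T₁.Adj i u := fun i hi =>
      hT₁.connected.preconnected.adj_of_compl_independent u (fun a b ha hb hab =>
        hFforest.not_triangle (hl a b hab (by rw [hu' a ha, hu' b hb])) (hlr b w (hu' b hb))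
          (hlr a w (hu' a ha)).symm) hi
    have hstar₂ : ∀ k, k ≠ w → T₂.Adj k w := fun k hk =>
      hT₂.connected.preconnected.adj_of_compl_independent w (fun a b ha hb hab =>
        hFforest.not_triangle (hr a b hab (by rw [← hur a ha, ← hur b hb]))
          (hlr u b (hur b hb)).symm (hlr u a (hur a ha))) hk
    let e : Equiv.Perm (Fin s ⊕ Fin t) := Equiv.swap (.inl u) (.inr w)
    have heu : e (.inl u) = .inr w := Equiv.swap_apply_left ..
    have hew : e (.inr w) = .inl u := Equiv.swap_apply_right ..
    have hel : ∀ i, i ≠ u → e (.inl i) = .inl i := fun i hi =>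
      Equiv.swap_apply_of_ne_of_ne (by simpa) (by simp)
    have her : ∀ k, k ≠ w → e (.inr k) = .inr k := fun k hk =>
      Equiv.swap_apply_of_ne_of_ne (by simp) (by simpa)
    refine containsCopy_Kstminus_sdiff hFforest _ _ e.toEmbedding (fun i k => ?_)
      (preconnected_of_forall_adj u fun i hi => ?_) (preconnected_of_forall_adj w fun k hk => ?_)
    · by_cases hi : i = u <;> by_cases hk : k = w
      · subst hi hk
        simpa [heu, hew] using (graphJoin_adj_inl_inr _ _).symm
      · subst hi
        simpa [heu, her k hk, graphJoin_adj_inr] using (hstar₂ k hk).symm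
      · subst hk
        simpa [hew, hel i hi, graphJoin_adj_inl] using hstar₁ i hi
      · simpa [hel i hi, her k hk] using graphJoin_adj_inl_inr _ _
    · simpa [heu, hel i hi] using (hlr i w (hu' i hi)).symm
    · simpa [hew, her k hk] using hlr u k (hur k hk)
  · push Not at hw
    have hrr : ∀ j j', c (.inr j) = c (.inr j') := fun j j' => two _ _ _ (hw j) (hw j')
    have hne : ∀ i j, c (.inl i) ≠ c (.inr j) := by
      intro i j hij
      obtain ⟨z, hz⟩ := hT₂.connected.preconnected.exists_adj_of_nontrivial j
      exact hFforest.not_triangle (hr j z hz (hrr j z))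
        (hlr i z (by rw [hij, hrr j z])).symm (hlr i j hij)
    have hll : ∀ i i', c (.inl i) = c (.inl i') := fun i i' =>
      two _ (c (.inr ⟨0, by omega⟩)) _ (hne _ _) (hne _ _)
    exact containsCopy_Kstminus_sdiff hFforest _ _ (Function.Embedding.refl _)
      graphJoin_adj_inl_inr
      (hT₁.connected.preconnected.mono fun a b h => hl a b h (hll a b))
      (hT₂.connected.preconnected.mono fun a b h => hr a b h (hrr a b))
end
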